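/- arXiv:2602.17862 — 3 statements merged into one kernel-verified Lean document; each statement's English description precedes it below -/
import Mathlib

section
/- Let ρₙ be a density matrix on ℂ^d, let Π⊥ be the orthogonal projection onto the orthogonal complement of the range of ρₙ, and let Δ be a Hermitian traceless d×d complex matrix such that for some ϑmax > 0 and every ϑ ∈ (0, ϑmax], the matrix ρₙ + ϑΔ is positive semidefinite. Fix q ∈ (0,1). Then there exist constants C > 0 and ϑ₁ ∈ (0, ϑmax] such that for all ϑ ∈ (0, ϑ₁], |Tr(ρₙ^q (ρₙ + ϑΔ)^{1−q}) − 1 − (1−q) ϑ Tr(Δ∥)| ≤ C ϑ², where Δ∥ := (1 − Π⊥) Δ (1 − Π⊥). -/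
open Matrix
open scoped ComplexOrder

/-- Functional calculus for a Hermitian matrix with the convention `f(0) := 0`,
so that `f(A) := Σⱼ f(λⱼ) Pⱼ` acts only on the support of `A`.  (Junk value `0`
if the matrix is not Hermitian.) -/
noncomputable def matFun {d : ℕ} (A : Matrix (Fin d) (Fin d) ℂ) (f : ℝ → ℝ) :
    Matrix (Fin d) (Fin d) ℂ :=
  if hA : A.IsHermitian then
    (hA.eigenvectorUnitary : Matrix (Fin d) (Fin d) ℂ) *
      Matrix.diagonal (fun i => if hA.eigenvalues i = 0 then 0 else (f (hA.eigenvalues i) : ℂ)) *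
      star (hA.eigenvectorUnitary : Matrix (Fin d) (Fin d) ℂ)
  else 0

/-- Matrix power `A^q := Σⱼ λⱼ^q Pⱼ` with the convention `0^q := 0`. -/
noncomputable def matRpow {d : ℕ} (A : Matrix (Fin d) (Fin d) ℂ) (q : ℝ) :
    Matrix (Fin d) (Fin d) ℂ :=
  matFun A (fun x => x ^ q)

/-- Global quadratic remainder bound for the tangent line of `x ↦ x ^ r` at `1`. -/
theorem abs_rpow_sub_tangent_le {r x : ℝ} (hr : r ∈ Set.Ioo (0 : ℝ) 1) (hx : 0 ≤ x) :
    |x ^ r - 1 - r * (x - 1)| ≤ (x - 1) ^ 2 := by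
  obtain ⟨hr0, hr1⟩ := hr
  have hupper {t : ℝ} (ht0 : 0 ≤ t) (ht1 : t ≤ 1) : x ^ t ≤ 1 + t * (x - 1) := by
    simpa using rpow_one_add_le_one_add_mul_self (s := x - 1) (by linarith) ht0 ht1
  rw [abs_le]
  refine ⟨?_, by nlinarith [hupper hr0.le hr1.le, sq_nonneg (x - 1)]⟩
  rcases hx.eq_or_lt with rfl | hx
  · rw [Real.zero_rpow hr0.ne']
    linarith
  have hmul : x ^ r * x ^ (1 - r) = x := by
    rw [← Real.rpow_add hx]
    simp
  have hle : x ≤ x ^ r * (1 + (1 - r) * (x - 1)) := by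
    calc x = x ^ r * x ^ (1 - r) := hmul.symm
      _ ≤ _ := by
        gcongr
        exact hupper (by linarith) (by linarith)
  have hpos : 0 < 1 + (1 - r) * (x - 1) := by nlinarith
  have hpoly : (1 + r * (x - 1) - (x - 1) ^ 2) * (1 + (1 - r) * (x - 1)) ≤ x := by
    have h : 0 ≤ (x - 1) ^ 2 * (r ^ 2 + (1 - r) * x) := by
      have := mul_pos (sub_pos.2 hr1) hx
      positivity
    linear_combination h
  have := le_of_mul_le_mul_right (hpoly.trans hle) hpos
  linarith

theorem abs_rpow_mul_rpow_sub_tangent_le {q p s : ℝ} (hq : q ∈ Set.Ioo (0 : ℝ) 1)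
    (hp : 0 < p) (hs : 0 ≤ s) :
    |p ^ q * s ^ (1 - q) - (p + (1 - q) * (s - p))| ≤ p⁻¹ * (s - p) ^ 2 := by
  have h := abs_rpow_sub_tangent_le (r := 1 - q) (x := s / p)
    ⟨by linarith [hq.2], by linarith [hq.1]⟩ (by positivity)
  have hpow : p ^ q * s ^ (1 - q) = p * (s / p) ^ (1 - q) := by
    rw [Real.div_rpow hs hp.le, Real.rpow_sub hp, Real.rpow_one]
    have := (Real.rpow_pos_of_pos hp q).ne'
    field_simp
  have hfactor : p ^ q * s ^ (1 - q) - (p + (1 - q) * (s - p)) =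
      p * ((s / p) ^ (1 - q) - 1 - (1 - q) * (s / p - 1)) := by
    rw [hpow]
    field_simp
    ring
  rw [hfactor, abs_mul, abs_of_pos hp]
  calc p * |(s / p) ^ (1 - q) - 1 - (1 - q) * (s / p - 1)| ≤ p * (s / p - 1) ^ 2 := by gcongr
    _ = p⁻¹ * (s - p) ^ 2 := by field_simp

theorem matRpow_eq {d : ℕ} {A : Matrix (Fin d) (Fin d) ℂ} (hA : A.IsHermitian) {q : ℝ}
    (hq : q ≠ 0) :
    matRpow A q = (hA.eigenvectorUnitary : Matrix (Fin d) (Fin d) ℂ) *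
      Matrix.diagonal (fun i => ((hA.eigenvalues i ^ q : ℝ) : ℂ)) *
      star (hA.eigenvectorUnitary : Matrix (Fin d) (Fin d) ℂ) := by
  rw [matRpow, matFun, dif_pos hA]
  congr 3
  ext i
  split_ifs with h
  · simp [h, Real.zero_rpow hq]
  · rfl

theorem trace_conj_diagonal_mul {n : Type*} [Fintype n] [DecidableEq n]
    (U V : Matrix n n ℂ) (f g : n → ℝ) :
    (Matrix.trace ((U * Matrix.diagonal (fun i => (f i : ℂ)) * star U) *
      (V * Matrix.diagonal (fun i => (g i : ℂ)) * star V))).re =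
      ∑ i, ∑ j, Complex.normSq ((star U * V) i j) * (f i * g j) := by
  have hcycle : Matrix.trace ((U * Matrix.diagonal (fun i => (f i : ℂ)) * star U) *
      (V * Matrix.diagonal (fun i => (g i : ℂ)) * star V)) =
      Matrix.trace (Matrix.diagonal (fun i => (f i : ℂ)) * (star U * V) *
        Matrix.diagonal (fun i => (g i : ℂ)) * star (star U * V)) := by
    simp only [Matrix.mul_assoc, star_mul, star_star]
    rw [Matrix.trace_mul_comm U]
    simp only [Matrix.mul_assoc]
  rw [hcycle]
  generalize star U * V = W
  simp only [Matrix.trace, Matrix.diag_apply, Matrix.mul_apply (N := star W),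
    Matrix.mul_diagonal, Matrix.diagonal_mul, Matrix.star_apply, Complex.re_sum]
  refine Finset.sum_congr rfl fun i _ => Finset.sum_congr rfl fun j _ => ?_
  simp [Complex.normSq_apply]
  ring

theorem sum_normSq_row_of_mul_star {n : Type*} [Fintype n] [DecidableEq n]
    {W : Matrix n n ℂ} (hW : W * star W = 1) (i : n) :
    ∑ j, Complex.normSq (W i j) = 1 := by
  have h := congrArg Complex.re (congrFun₂ hW i i)
  simpa [Matrix.mul_apply, Complex.normSq_apply] using h

theorem sum_normSq_eq_trace {n : Type*} [Fintype n] (M : Matrix n n ℂ) :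
    ∑ i, ∑ j, Complex.normSq (M i j) = (Matrix.trace (M * star M)).re := by
  simp [Matrix.trace, Matrix.mul_apply, Complex.normSq_apply]

/-- The spectral support projection is the complement of any orthogonal projection onto the
kernel. -/
theorem support_projection_eq {d : ℕ} {A P : Matrix (Fin d) (Fin d) ℂ} (hA : A.IsHermitian)
    (hPherm : P.IsHermitian) (hPidem : P * P = P)
    (hPker : ∀ x : Fin d → ℂ, P *ᵥ x = x ↔ A *ᵥ x = 0) :
    (hA.eigenvectorUnitary : Matrix (Fin d) (Fin d) ℂ) *
      Matrix.diagonal (fun i => if hA.eigenvalues i = 0 then 0 else 1) *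
      star (hA.eigenvectorUnitary : Matrix (Fin d) (Fin d) ℂ) = 1 - P := by
  set U := (hA.eigenvectorUnitary : Matrix (Fin d) (Fin d) ℂ) with hU
  set E : Matrix (Fin d) (Fin d) ℂ :=
    Matrix.diagonal (fun i => if hA.eigenvalues i = 0 then 0 else 1) with hE
  set D : Matrix (Fin d) (Fin d) ℂ := Matrix.diagonal (fun i => (hA.eigenvalues i : ℂ)) with hD
  have hUU : star U * U = 1 := Unitary.coe_star_mul_self _
  have hspec : A = U * D * star U := hA.spectral_theorem
  have hUA : star U * A = D * star U := by
    rw [hspec]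
    simp only [← Matrix.mul_assoc, hUU, Matrix.one_mul]
  have hmul (X : Matrix (Fin d) (Fin d) ℂ) : P * X = X ↔ A * X = 0 := by
    constructor <;> intro h <;> ext i j
    · exact congrFun ((hPker (X.col j)).1 (funext fun k => congrFun₂ h k j)) i
    · exact congrFun ((hPker (X.col j)).2 (funext fun k => congrFun₂ h k j)) i
  have hDE : D * E = D := by
    rw [hD, hE, Matrix.diagonal_mul_diagonal]
    congr 1
    ext i
    split_ifs with h <;> simp [h]
  have hED : Matrix.diagonal (fun i => (hA.eigenvalues i : ℂ)⁻¹) * D = E := by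
    rw [hD, hE, Matrix.diagonal_mul_diagonal]
    congr 1
    ext i
    split_ifs with h <;> simp [h]
  have hPQ : P * (1 - U * E * star U) = 1 - U * E * star U := by
    rw [hmul, Matrix.mul_sub, Matrix.mul_one, sub_eq_zero]
    conv_lhs => rw [hspec, ← hDE]
    rw [hspec]
    simp only [Matrix.mul_assoc]
    rw [← Matrix.mul_assoc (star U) U, hUU, Matrix.one_mul]
  have hEP : U * E * star U * P = 0 := by
    have h : D * star U * P = 0 := by
      rw [← hUA, Matrix.mul_assoc, (hmul P).1 hPidem, Matrix.mul_zero]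
    rw [← hED]
    simp only [Matrix.mul_assoc] at h ⊢
    simp [h]
  have hEherm : star (U * E * star U) = U * E * star U := by
    have : star E = E := by
      rw [hE, Matrix.star_eq_conjTranspose, Matrix.diagonal_conjTranspose]
      congr 1
      ext i
      simp only [Pi.star_apply]
      split_ifs <;> simp
    simp only [star_mul, star_star, this, Matrix.mul_assoc]
  have hQP := congrArg star hPQ
  rw [star_mul, star_sub, hEherm, star_one, show star P = P from hPherm, Matrix.sub_mul, hEP,
    Matrix.one_mul, sub_zero] at hQP
  rw [hQP]
  abel

theorem sum_support_diag_re_eq {d : ℕ} {A P : Matrix (Fin d) (Fin d) ℂ} (hA : A.IsHermitian)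
    (hPherm : P.IsHermitian) (hPidem : P * P = P)
    (hPker : ∀ x : Fin d → ℂ, P *ᵥ x = x ↔ A *ᵥ x = 0) (Δ : Matrix (Fin d) (Fin d) ℂ) :
    ∑ i, (if hA.eigenvalues i = 0 then 0 else
      ((star (hA.eigenvectorUnitary : Matrix (Fin d) (Fin d) ℂ) * Δ *
        (hA.eigenvectorUnitary : Matrix (Fin d) (Fin d) ℂ)) i i).re) =
      (Matrix.trace ((1 - P) * Δ * (1 - P))).re := by
  have hidem : (1 - P) * (1 - P) = 1 - P := by
    rw [Matrix.mul_sub, Matrix.sub_mul, Matrix.sub_mul, hPidem]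
    simp
  rw [Matrix.trace_mul_comm, ← Matrix.mul_assoc, hidem,
    ← support_projection_eq hA hPherm hPidem hPker, Matrix.mul_assoc, Matrix.mul_assoc,
    Matrix.trace_mul_comm, Matrix.mul_assoc, Matrix.trace, Complex.re_sum]
  refine Finset.sum_congr rfl fun i _ => ?_
  simp only [Matrix.diag_apply, ← Matrix.mul_assoc, Matrix.mul_diagonal]
  split_ifs with h <;> simp

/-- Second-order expansion in spectral form, for nonnegative Hermitian matrices with eigenbases
`U`, `V` and eigenvalues `p`, `s` that differ by `ϑ • Δ`. -/
theorem abs_sum_normSq_mul_rpow_sub_le {d : ℕ} {A Δ U V : Matrix (Fin d) (Fin d) ℂ}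
    {p s : Fin d → ℝ} {ϑ q : ℝ} (hq : q ∈ Set.Ioo (0 : ℝ) 1)
    (hUU : star U * U = 1) (hUU' : U * star U = 1) (hVV : star V * V = 1)
    (hVV' : V * star V = 1) (hp0 : ∀ i, 0 ≤ p i) (hs0 : ∀ j, 0 ≤ s j)
    (hA : A = U * Matrix.diagonal (fun i => (p i : ℂ)) * star U)
    (hB : A + ϑ • Δ = V * Matrix.diagonal (fun i => (s i : ℂ)) * star V) :
    |∑ i, ∑ j, Complex.normSq ((star U * V) i j) * (p i ^ q * s j ^ (1 - q)) -
      (∑ i, p i + (1 - q) * ϑ * ∑ i, (if p i = 0 then 0 else ((star U * Δ * U) i i).re))| ≤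
      (Matrix.trace (Δ * star Δ)).re * (∑ i, ∑ _j : Fin d, (p i)⁻¹) * ϑ ^ 2 := by
  set K : ℝ := (Matrix.trace (Δ * star Δ)).re with hK
  have hq0 : q ≠ 0 := hq.1.ne'
  have hspecA : star U * A = Matrix.diagonal (fun i => (p i : ℂ)) * star U := by
    rw [hA]
    simp only [← Matrix.mul_assoc, hUU, Matrix.one_mul]
  have hspecB : (A + ϑ • Δ) * V = V * Matrix.diagonal (fun i => (s i : ℂ)) := by
    rw [hB, Matrix.mul_assoc, hVV, Matrix.mul_one]
  set W := star U * V with hW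
  set M := star U * Δ * V with hM
  have hWW : W * star W = 1 := by
    rw [hW, star_mul, star_star, Matrix.mul_assoc, ← Matrix.mul_assoc V, hVV', Matrix.one_mul, hUU]
  have hMW : M * star W = star U * Δ * U := by
    rw [hM, hW, star_mul, star_star, Matrix.mul_assoc, ← Matrix.mul_assoc V, hVV', Matrix.one_mul]
  have hWM (i j : Fin d) : W i j * ((s j - p i : ℝ) : ℂ) = ϑ * M i j := by
    have h : W * Matrix.diagonal (fun i => (s i : ℂ)) =
        Matrix.diagonal (fun i => (p i : ℂ)) * W + ϑ • M := by
      rw [hW, Matrix.mul_assoc, ← hspecB, Matrix.add_mul, Matrix.mul_add, ← Matrix.mul_assoc,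
        hspecA, Matrix.mul_assoc, hM]
      simp only [Matrix.smul_mul, Matrix.mul_smul, Matrix.mul_assoc]
    have h := congrFun₂ h i j
    rw [Matrix.mul_diagonal, Matrix.add_apply, Matrix.diagonal_mul, Matrix.smul_apply,
      Complex.real_smul] at h
    push_cast
    linear_combination h
  have hsq (i j : Fin d) :
      Complex.normSq (W i j) * (s j - p i) ^ 2 = ϑ ^ 2 * Complex.normSq (M i j) := by
    have h := congrArg Complex.normSq (hWM i j)
    rw [Complex.normSq_mul, Complex.normSq_mul, Complex.normSq_ofReal, Complex.normSq_ofReal] at h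
    linear_combination h
  have hMK (i j : Fin d) : Complex.normSq (M i j) ≤ K := by
    have h : Matrix.trace (M * star M) = Matrix.trace (Δ * star Δ) := by
      have h : M * star M = star U * (Δ * star Δ * U) := by
        rw [hM]
        simp only [star_mul, star_star, Matrix.mul_assoc]
        rw [← Matrix.mul_assoc V, hVV', Matrix.one_mul]
      rw [h, Matrix.trace_mul_comm, Matrix.mul_assoc, hUU', Matrix.mul_one]
    rw [hK, ← h, ← sum_normSq_eq_trace]
    refine (Finset.single_le_sum (f := fun j => Complex.normSq (M i j))
      (fun _ _ => Complex.normSq_nonneg _) (Finset.mem_univ j)).trans ?_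
    exact Finset.single_le_sum (f := fun i => ∑ j, Complex.normSq (M i j))
      (fun _ _ => Finset.sum_nonneg fun _ _ => Complex.normSq_nonneg _) (Finset.mem_univ i)
  have hfirst (i : Fin d) : ∑ j, Complex.normSq (W i j) * (s j - p i) =
      ϑ * ((star U * Δ * U) i i).re := by
    rw [← hMW, Matrix.mul_apply, Complex.re_sum, Finset.mul_sum]
    refine Finset.sum_congr rfl fun j _ => ?_
    rw [← Complex.re_ofReal_mul, ← mul_assoc, ← hWM, Matrix.star_apply, Complex.star_def,
      mul_right_comm, Complex.mul_conj, ← Complex.ofReal_mul, Complex.ofReal_re]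
  have hlin : ∑ i, p i + (1 - q) * ϑ * ∑ i, (if p i = 0 then 0 else ((star U * Δ * U) i i).re) =
      ∑ i, ∑ j, Complex.normSq (W i j) *
        (if p i = 0 then 0 else p i + (1 - q) * (s j - p i)) := by
    rw [Finset.mul_sum, ← Finset.sum_add_distrib]
    refine Finset.sum_congr rfl fun i _ => ?_
    split_ifs with h
    · simp [h]
    · simp only [mul_add, Finset.sum_add_distrib]
      rw [← Finset.sum_mul, sum_normSq_row_of_mul_star hWW]
      simp only [mul_left_comm _ (1 - q)]
      rw [← Finset.mul_sum, hfirst]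
      ring
  rw [hlin, ← Finset.sum_sub_distrib]
  have hterm (i j : Fin d) : |Complex.normSq (W i j) * (p i ^ q * s j ^ (1 - q)) -
      Complex.normSq (W i j) * (if p i = 0 then 0 else p i + (1 - q) * (s j - p i))| ≤
      K * (p i)⁻¹ * ϑ ^ 2 := by
    rw [← mul_sub, abs_mul, abs_of_nonneg (Complex.normSq_nonneg _)]
    split_ifs with h
    · simp [h, Real.zero_rpow hq0]
    have hpi : 0 < p i := (hp0 i).lt_of_ne' h
    calc _ ≤ Complex.normSq (W i j) * ((p i)⁻¹ * (s j - p i) ^ 2) :=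
          mul_le_mul_of_nonneg_left (abs_rpow_mul_rpow_sub_tangent_le hq hpi (hs0 j))
            (Complex.normSq_nonneg _)
      _ = (p i)⁻¹ * ϑ ^ 2 * Complex.normSq (M i j) := by
          linear_combination (p i)⁻¹ * hsq i j
      _ ≤ (p i)⁻¹ * ϑ ^ 2 * K := by
          gcongr
          exact hMK i j
      _ = _ := by ring
  calc _ ≤ ∑ i, ∑ j : Fin d, K * (p i)⁻¹ * ϑ ^ 2 := by
        refine (Finset.abs_sum_le_sum_abs _ _).trans (Finset.sum_le_sum fun i _ => ?_)
        rw [← Finset.sum_sub_distrib]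
        exact (Finset.abs_sum_le_sum_abs _ _).trans (Finset.sum_le_sum fun j _ => hterm i j)
    _ = K * (∑ i, ∑ _j : Fin d, (p i)⁻¹) * ϑ ^ 2 := by
        simp only [Finset.mul_sum, Finset.sum_mul]

/-- Second-order expansion of `Tr(ρₙ^q (ρₙ + ϑΔ)^{1−q})`:
`Tr(ρₙ^q (ρₙ + ϑΔ)^{1−q}) = 1 + (1−q) ϑ Tr(Δ∥) + O(ϑ²)` where
`Δ∥ := (1 − Π⊥) Δ (1 − Π⊥)`. -/
theorem trace_rpow_expansion {d : ℕ}
    (ρn Pperp Δ : Matrix (Fin d) (Fin d) ℂ)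
    (hρ : ρn.PosSemidef) (hρtr : ρn.trace = 1)
    (hPherm : Pperp.IsHermitian) (hPidem : Pperp * Pperp = Pperp)
    (hPker : ∀ x : Fin d → ℂ, Pperp *ᵥ x = x ↔ ρn *ᵥ x = 0)
    (hΔherm : Δ.IsHermitian) (hΔtr : Δ.trace = 0)
    (ϑmax : ℝ) (hϑmax : 0 < ϑmax)
    (hpsd : ∀ ϑ ∈ Set.Ioc (0 : ℝ) ϑmax, (ρn + ϑ • Δ).PosSemidef)
    (q : ℝ) (hq : q ∈ Set.Ioo (0 : ℝ) 1) :
    ∃ C > (0 : ℝ), ∃ ϑ₁ ∈ Set.Ioc (0 : ℝ) ϑmax, ∀ ϑ ∈ Set.Ioc (0 : ℝ) ϑ₁,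
      |(Matrix.trace (matRpow ρn q * matRpow (ρn + ϑ • Δ) (1 - q))).re
        - 1 - (1 - q) * ϑ * (Matrix.trace ((1 - Pperp) * Δ * (1 - Pperp))).re|
        ≤ C * ϑ ^ 2 := by
  refine ⟨(Matrix.trace (Δ * star Δ)).re * (∑ i, ∑ _j : Fin d, (hρ.1.eigenvalues i)⁻¹) + 1, ?_,
    ϑmax, ⟨hϑmax, le_rfl⟩, fun ϑ hϑ => ?_⟩
  · have htr : 0 ≤ (Matrix.trace (Δ * star Δ)).re := by
      rw [← sum_normSq_eq_trace]
      exact Finset.sum_nonneg fun i _ => Finset.sum_nonneg fun j _ => Complex.normSq_nonneg _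
    have hinv : 0 ≤ ∑ i, ∑ _j : Fin d, (hρ.1.eigenvalues i)⁻¹ :=
      Finset.sum_nonneg fun i _ => Finset.sum_nonneg fun _ _ =>
        inv_nonneg.2 (hρ.eigenvalues_nonneg i)
    linarith [mul_nonneg htr hinv]
  have hσ := hpsd ϑ hϑ
  have hpsum : ∑ i, hρ.1.eigenvalues i = 1 := by
    have h : ((∑ i, hρ.1.eigenvalues i : ℝ) : ℂ) = 1 := by
      rw [← hρtr, hρ.1.trace_eq_sum_eigenvalues]
      simp
    exact_mod_cast h
  have h := abs_sum_normSq_mul_rpow_sub_le hq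
    (Unitary.coe_star_mul_self hρ.1.eigenvectorUnitary)
    (Unitary.coe_mul_star_self hρ.1.eigenvectorUnitary)
    (Unitary.coe_star_mul_self hσ.1.eigenvectorUnitary)
    (Unitary.coe_mul_star_self hσ.1.eigenvectorUnitary)
    hρ.eigenvalues_nonneg hσ.eigenvalues_nonneg hρ.1.spectral_theorem hσ.1.spectral_theorem
  rw [hpsum, sum_support_diag_re_eq hρ.1 hPherm hPidem hPker] at h
  rw [matRpow_eq hρ.1 hq.1.ne', matRpow_eq hσ.1 (sub_pos.2 hq.2).ne', trace_conj_diagonal_mul,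
    sub_sub]
  linarith [sq_nonneg ϑ]
end

section
/- Let ρ and σ be density matrices on ℂ^d such that the range of ρ is contained in the range of σ. Then the quantum Tsallis relative entropy converges to the quantum relative entropy as q → 1 from below: the limit of (1 − Tr(ρ^q σ^{1−q}))/(1 − q), as q tends to 1 within (0,1), equals Tr[ρ(log ρ − log σ)]. -/
open Matrix
open scoped ComplexOrder

/-- `log` of a Hermitian matrix, acting only on its support. -/
noncomputable def matLog {d : ℕ} (A : Matrix (Fin d) (Fin d) ℂ) : Matrix (Fin d) (Fin d) ℂ :=
  matFun A Real.log

/-- Quantum relative entropy `D(ρ‖σ) = Tr[ρ (log ρ − log σ)]`. -/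
noncomputable def relEntropy {d : ℕ} (ρ σ : Matrix (Fin d) (Fin d) ℂ) : ℝ :=
  (Matrix.trace (ρ * (matLog ρ - matLog σ))).re

/-- The squared modulus of the overlap of the `i`-th eigenvector of `A` with the `j`-th one of `B`. -/
noncomputable def eigenOverlap {d : ℕ} {A B : Matrix (Fin d) (Fin d) ℂ}
    (hA : A.IsHermitian) (hB : B.IsHermitian) (i j : Fin d) : ℝ :=
  Complex.normSq ((star (hA.eigenvectorUnitary : Matrix (Fin d) (Fin d) ℂ) *
    (hB.eigenvectorUnitary : Matrix (Fin d) (Fin d) ℂ)) i j)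

theorem sum_normSq_row_of_mem_unitaryGroup {d : ℕ} {W : Matrix (Fin d) (Fin d) ℂ}
    (hW : W ∈ Matrix.unitaryGroup (Fin d) ℂ) (i : Fin d) :
    ∑ j, Complex.normSq (W i j) = 1 := by
  have h := congrFun (congrFun (Matrix.mem_unitaryGroup_iff.mp hW) i) i
  simp only [Matrix.mul_apply, Matrix.star_apply, Matrix.one_apply_eq, RCLike.star_def,
    Complex.mul_conj] at h
  exact_mod_cast h

theorem trace_diagonal_mul_mul_diagonal_mul_star {d : ℕ} (a b : Fin d → ℂ)
    (W : Matrix (Fin d) (Fin d) ℂ) :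
    Matrix.trace (Matrix.diagonal a * W * Matrix.diagonal b * star W) =
      ∑ i, ∑ j, a i * b j * (Complex.normSq (W i j) : ℂ) := by
  simp only [Matrix.trace, Matrix.diag_apply, Matrix.mul_apply (N := star W), Matrix.mul_diagonal,
    Matrix.diagonal_mul, Matrix.star_apply, RCLike.star_def, ← Complex.mul_conj]
  exact Finset.sum_congr rfl fun i _ => Finset.sum_congr rfl fun j _ => by ring

section

variable {d : ℕ} {A B : Matrix (Fin d) (Fin d) ℂ}

theorem sum_eigenOverlap (hA : A.IsHermitian) (hB : B.IsHermitian) (i : Fin d) :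
    ∑ j, eigenOverlap hA hB i j = 1 :=
  sum_normSq_row_of_mem_unitaryGroup
    (mul_mem (Unitary.star_mem hA.eigenvectorUnitary.2) hB.eigenvectorUnitary.2) i

theorem eigenOverlap_self (hA : A.IsHermitian) (i j : Fin d) :
    eigenOverlap hA hA i j = if i = j then 1 else 0 := by
  rw [eigenOverlap, Unitary.coe_star_mul_self, Matrix.one_apply]
  split_ifs <;> simp

theorem re_trace_matFun_mul_matFun (hA : A.IsHermitian) (hB : B.IsHermitian) (f g : ℝ → ℝ) :
    (Matrix.trace (matFun A f * matFun B g)).re =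
      ∑ i, ∑ j, (if hA.eigenvalues i = 0 then 0 else f (hA.eigenvalues i)) *
        (if hB.eigenvalues j = 0 then 0 else g (hB.eigenvalues j)) * eigenOverlap hA hB i j := by
  rw [matFun, matFun, dif_pos hA, dif_pos hB]
  set U := (hA.eigenvectorUnitary : Matrix (Fin d) (Fin d) ℂ) with hU
  set V := (hB.eigenvectorUnitary : Matrix (Fin d) (Fin d) ℂ) with hV
  set a : Fin d → ℂ := fun i => if hA.eigenvalues i = 0 then 0 else (f (hA.eigenvalues i) : ℂ)
    with ha
  set b : Fin d → ℂ := fun i => if hB.eigenvalues i = 0 then 0 else (g (hB.eigenvalues i) : ℂ)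
    with hb
  have h : Matrix.trace (U * Matrix.diagonal a * star U * (V * Matrix.diagonal b * star V)) =
      Matrix.trace (Matrix.diagonal a * (star U * V) * Matrix.diagonal b * star (star U * V)) := by
    rw [star_mul, star_star, Matrix.mul_assoc U, Matrix.mul_assoc U, Matrix.trace_mul_comm U]
    simp only [Matrix.mul_assoc]
  rw [h, trace_diagonal_mul_mul_diagonal_mul_star, Complex.re_sum]
  refine Finset.sum_congr rfl fun i _ => ?_
  rw [Complex.re_sum]
  refine Finset.sum_congr rfl fun j _ => ?_
  rw [eigenOverlap, ← hU, ← hV, ha, hb]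
  by_cases hi : hA.eigenvalues i = 0 <;> by_cases hj : hB.eigenvalues j = 0 <;> simp [hi, hj]

theorem matFun_id (hA : A.IsHermitian) : matFun A (fun x => x) = A := by
  rw [matFun, dif_pos hA]
  conv_rhs => rw [hA.spectral_theorem]
  rw [Unitary.conjStarAlgAut_apply]
  congr 3
  ext i
  simp only [Function.comp_apply]
  split_ifs with h <;> simp [h]

theorem eigenvalues_mul_eigenOverlap_eq_zero (hA : A.IsHermitian) (hB : B.IsHermitian)
    (hker : ∀ x : Fin d → ℂ, B *ᵥ x = 0 → A *ᵥ x = 0) {i j : Fin d}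
    (hj : hB.eigenvalues j = 0) : hA.eigenvalues i * eigenOverlap hA hB i j = 0 := by
  set U := (hA.eigenvectorUnitary : Matrix (Fin d) (Fin d) ℂ) with hU
  set V := (hB.eigenvectorUnitary : Matrix (Fin d) (Fin d) ℂ) with hV
  have hBv : A *ᵥ (V.col j) = 0 := by
    refine hker _ ?_
    have := hB.mulVec_eigenvectorBasis j
    rw [hj, zero_smul] at this
    exact this
  have hAV : ∀ k, (A * V) k j = 0 := fun k => congrFun hBv k
  have hspec : star U * A = Matrix.diagonal (fun i => (hA.eigenvalues i : ℂ)) * star U := by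
    conv_lhs => rw [hA.spectral_theorem, Unitary.conjStarAlgAut_apply]
    rw [← Matrix.mul_assoc, ← Matrix.mul_assoc, hU, Unitary.coe_star_mul_self, Matrix.one_mul]
    rfl
  have h : (hA.eigenvalues i : ℂ) * (star U * V) i j = 0 := by
    rw [← Matrix.diagonal_mul (fun i => (hA.eigenvalues i : ℂ)), ← Matrix.mul_assoc, ← hspec,
      Matrix.mul_assoc, Matrix.mul_apply]
    exact Finset.sum_eq_zero fun k _ => by rw [hAV, mul_zero]
  rw [eigenOverlap, ← hU, ← hV]
  rcases mul_eq_zero.mp h with h | h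
  · rw [Complex.ofReal_eq_zero.mp h, zero_mul]
  · rw [h, map_zero, mul_zero]

theorem relEntropy_eq_sum (hA : A.IsHermitian) (hB : B.IsHermitian) :
    relEntropy A B = ∑ i, ∑ j, hA.eigenvalues i *
      (Real.log (hA.eigenvalues i) - Real.log (hB.eigenvalues j)) * eigenOverlap hA hB i j := by
  have hAA := re_trace_matFun_mul_matFun hA hA (fun x => x) Real.log
  have hAB := re_trace_matFun_mul_matFun hA hB (fun x => x) Real.log
  rw [matFun_id hA] at hAA hAB
  rw [relEntropy, Matrix.mul_sub, Matrix.trace_sub, Complex.sub_re, matLog, matLog, hAA, hAB,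
    ← Finset.sum_sub_distrib]
  refine Finset.sum_congr rfl fun i _ => ?_
  have hrow : ∑ j, hA.eigenvalues i * Real.log (hA.eigenvalues i) * eigenOverlap hA hB i j =
      hA.eigenvalues i * Real.log (hA.eigenvalues i) := by
    rw [← Finset.mul_sum, sum_eigenOverlap, mul_one]
  simp only [mul_sub, sub_mul, Finset.sum_sub_distrib, hrow, eigenOverlap_self, mul_ite, mul_one,
    mul_zero, Finset.sum_ite_eq, Finset.mem_univ, if_true]
  congr 1
  · split_ifs with h <;> simp [h]
  · refine Finset.sum_congr rfl fun j _ => ?_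
    by_cases hi : hA.eigenvalues i = 0 <;> by_cases hj : hB.eigenvalues j = 0 <;> simp [hi, hj]

theorem re_trace_matRpow_mul_matRpow (hA : A.IsHermitian) (hB : B.IsHermitian) (p q : ℝ) :
    (Matrix.trace (matRpow A p * matRpow B q)).re =
      ∑ i, ∑ j, (if hA.eigenvalues i = 0 then 0 else hA.eigenvalues i ^ p) *
        (if hB.eigenvalues j = 0 then 0 else hB.eigenvalues j ^ q) * eigenOverlap hA hB i j :=
  re_trace_matFun_mul_matFun hA hB _ _

theorem re_trace_matRpow_one_mul_matRpow_zero (hA : A.IsHermitian) (hB : B.IsHermitian)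
    (hker : ∀ x : Fin d → ℂ, B *ᵥ x = 0 → A *ᵥ x = 0) :
    (Matrix.trace (matRpow A 1 * matRpow B 0)).re = A.trace.re := by
  rw [re_trace_matRpow_mul_matRpow hA hB, hA.trace_eq_sum_eigenvalues, Complex.re_sum]
  refine Finset.sum_congr rfl fun i _ => ?_
  have hrow : ∑ j, hA.eigenvalues i * eigenOverlap hA hB i j = hA.eigenvalues i := by
    rw [← Finset.mul_sum, sum_eigenOverlap, mul_one]
  trans ∑ j, hA.eigenvalues i * eigenOverlap hA hB i j
  · refine Finset.sum_congr rfl fun j _ => ?_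
    by_cases hj : hB.eigenvalues j = 0
    · simp [hj, eigenvalues_mul_eigenOverlap_eq_zero hA hB hker hj]
    · by_cases hi : hA.eigenvalues i = 0 <;> simp [hi, hj]
  · simp [hrow]

theorem hasDerivAt_re_trace_matRpow_mul_matRpow (hA : A.PosSemidef) (hB : B.PosSemidef)
    (hker : ∀ x : Fin d → ℂ, B *ᵥ x = 0 → A *ᵥ x = 0) :
    HasDerivAt (fun q : ℝ => (Matrix.trace (matRpow A q * matRpow B (1 - q))).re)
      (relEntropy A B) 1 := by
  simp only [re_trace_matRpow_mul_matRpow hA.isHermitian hB.isHermitian,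
    relEntropy_eq_sum hA.isHermitian hB.isHermitian]
  refine HasDerivAt.fun_sum fun i _ => HasDerivAt.fun_sum fun j _ => ?_
  by_cases hi : hA.isHermitian.eigenvalues i = 0
  · simpa [hi] using hasDerivAt_const (1 : ℝ) (0 : ℝ)
  by_cases hj : hB.isHermitian.eigenvalues j = 0
  · have h := eigenvalues_mul_eigenOverlap_eq_zero hA.isHermitian hB.isHermitian hker (i := i) hj
    rw [mul_right_comm, h, zero_mul]
    simpa [hj] using hasDerivAt_const (1 : ℝ) (0 : ℝ)
  have hi' := (hA.eigenvalues_nonneg i).lt_of_ne' hi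
  have hj' := (hB.eigenvalues_nonneg j).lt_of_ne' hj
  simp only [if_neg hi, if_neg hj]
  have h := (((hasDerivAt_id (1 : ℝ)).const_rpow hi').mul
    (((hasDerivAt_id (1 : ℝ)).const_sub 1).const_rpow hj')).mul_const
      (eigenOverlap hA.isHermitian hB.isHermitian i j)
  refine h.congr_deriv ?_
  simp only [id_eq, Real.rpow_one, sub_self, Real.rpow_zero]
  ring

end

/-- The quantum Tsallis relative entropy `(1 − Tr(ρ^q σ^{1−q}))/(1 − q)` converges to the
quantum relative entropy `D(ρ‖σ)` as `q → 1⁻` (within `(0,1)`), provided the range of `ρ`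
is contained in the range of `σ`. -/
theorem tsallis_tendsto_relEntropy {d : ℕ}
    (ρ σ : Matrix (Fin d) (Fin d) ℂ)
    (hρ : ρ.PosSemidef) (hρtr : ρ.trace = 1)
    (hσ : σ.PosSemidef) (hσtr : σ.trace = 1)
    (hrange : ∀ x : Fin d → ℂ, σ *ᵥ x = 0 → ρ *ᵥ x = 0) :
    Filter.Tendsto
      (fun q : ℝ => (1 - (Matrix.trace (matRpow ρ q * matRpow σ (1 - q))).re) / (1 - q))
      (nhdsWithin 1 (Set.Ioo (0 : ℝ) 1))
      (nhds (relEntropy ρ σ)) := by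
  have hderiv := hasDerivAt_re_trace_matRpow_mul_matRpow hρ hσ hrange
  have hone := re_trace_matRpow_one_mul_matRpow_zero hρ.isHermitian hσ.isHermitian hrange
  rw [hρtr, Complex.one_re] at hone
  have hslope := (hasDerivAt_iff_tendsto_slope.mp hderiv).mono_left
    (nhdsWithin_mono 1 fun q (hq : q ∈ Set.Ioo (0 : ℝ) 1) => hq.2.ne)
  refine hslope.congr fun q => ?_
  rw [slope_def_field, sub_self, hone, ← neg_sub, ← neg_sub 1 q, neg_div_neg_eq]
end

section
/- Let S₀ and S₁ be sets of density matrices on ℂ^d, each invariant under conjugation ρ ↦ U ρ U† by every unitary d×d matrix U. Let O be a Hermitian matrix indexed by (Fin M → Fin d) with 0 ⪯ O ⪯ I. Suppose ρ₀ ∈ S₀ satisfies Tr(O ρ₀^{⊗M}) ≤ Tr(O σ^{⊗M}) for all σ ∈ S₀, and ρ₁ ∈ S₁ satisfies Tr(O ρ₁^{⊗M}) ≥ Tr(O σ^{⊗M}) for all σ ∈ S₁. Let Ō := (1/M!) Σ_{π} U_π† O U_π (sum over all permutations π of Fin M) and let Ō̄ := ∫ (U^{⊗M})† Ō U^{⊗M}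 dμ(U), the Bochner integral with respect to the Haar probability measure μ on the unitary group of d×d complex matrices. Then Tr(Ō̄ ρ₀^{⊗M}) ≥ Tr(O ρ₀^{⊗M}) and Tr(Ō̄ ρ₁^{⊗M}) ≤ Tr(O ρ₁^{⊗M}); i.e., the doubly averaged measurement operator achieves equal or better worst-case type 1 and type 2 errors than O. -/
open Matrix MeasureTheory
open scoped ComplexOrder

noncomputable instance matrixMeasurableSpace {d : ℕ} :
    MeasurableSpace (Matrix (Fin d) (Fin d) ℂ) := borel _

instance matrixBorelSpace {d : ℕ} : BorelSpace (Matrix (Fin d) (Fin d) ℂ) := ⟨rfl⟩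

/-- The `M`-fold tensor (Kronecker) power of a matrix, indexed by `Fin M → Fin d`:
`ρ^{⊗M}(i,j) = ∏ₖ ρ (i k) (j k)`. -/
noncomputable def tensorPow (d M : ℕ) (ρ : Matrix (Fin d) (Fin d) ℂ) :
    Matrix (Fin M → Fin d) (Fin M → Fin d) ℂ :=
  Matrix.of fun i j => ∏ k : Fin M, ρ (i k) (j k)

/-- The permutation unitary `U_π` on `(ℂ^d)^{⊗M}`: the permutation matrix, on the index set
`Fin M → Fin d`, of the bijection `i ↦ i ∘ π`. -/
def permUnitary (d M : ℕ) (π : Equiv.Perm (Fin M)) :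
    Matrix (Fin M → Fin d) (Fin M → Fin d) ℂ :=
  Matrix.of fun i j => if i = j ∘ π then 1 else 0

/-- The permutation average `Ō := (1/M!) Σ_π U_π† O U_π`. -/
noncomputable def permAvg (d M : ℕ) (O : Matrix (Fin M → Fin d) (Fin M → Fin d) ℂ) :
    Matrix (Fin M → Fin d) (Fin M → Fin d) ℂ :=
  ((M.factorial : ℂ))⁻¹ • ∑ π : Equiv.Perm (Fin M),
    (permUnitary d M π)ᴴ * O * permUnitary d M π

/-- The unitary (Haar) average `Ō̄ := ∫ (U^{⊗M})† Ō U^{⊗M} dμ(U)`, computed entrywise. -/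
noncomputable def unitaryAvg (d M : ℕ) (μ : Measure (Matrix.unitaryGroup (Fin d) ℂ))
    (O : Matrix (Fin M → Fin d) (Fin M → Fin d) ℂ) :
    Matrix (Fin M → Fin d) (Fin M → Fin d) ℂ :=
  Matrix.of fun i j =>
    ∫ U : Matrix.unitaryGroup (Fin d) ℂ,
      ((tensorPow d M (U : Matrix (Fin d) (Fin d) ℂ))ᴴ * permAvg d M O *
        tensorPow d M (U : Matrix (Fin d) (Fin d) ℂ)) i j ∂μ

lemma tensorPow_mul (d M : ℕ) (A B : Matrix (Fin d) (Fin d) ℂ) :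
    tensorPow d M (A * B) = tensorPow d M A * tensorPow d M B := by
  ext i j
  simp only [tensorPow, Matrix.of_apply, Matrix.mul_apply, Finset.prod_univ_sum,
    Fintype.piFinset_univ, Finset.prod_mul_distrib]

lemma tensorPow_conjTranspose (d M : ℕ) (A : Matrix (Fin d) (Fin d) ℂ) :
    tensorPow d M Aᴴ = (tensorPow d M A)ᴴ := by
  ext i j
  simp [tensorPow, Matrix.conjTranspose_apply]

lemma permUnitary_mul_conjTranspose (d M : ℕ) (π : Equiv.Perm (Fin M)) :
    permUnitary d M π * (permUnitary d M π)ᴴ = 1 := by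
  ext i j
  rw [Matrix.mul_apply, Finset.sum_eq_single (i ∘ π.symm)]
  · have h : (i ∘ π.symm) ∘ π = i := by ext k; simp
    simp [permUnitary, Matrix.conjTranspose_apply, h, Matrix.one_apply, eq_comm]
  · intro k _ hk
    have h : i ≠ k ∘ π := by
      rintro rfl
      exact hk (by ext x; simp)
    simp [permUnitary, h]
  · simp

lemma commute_permUnitary_tensorPow (d M : ℕ) (π : Equiv.Perm (Fin M))
    (A : Matrix (Fin d) (Fin d) ℂ) :
    Commute (permUnitary d M π) (tensorPow d M A) := by
  ext i j
  have h₁ : (permUnitary d M π * tensorPow d M A) i j = tensorPow d M A (i ∘ π.symm) j := by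
    rw [Matrix.mul_apply, Finset.sum_eq_single (i ∘ π.symm)]
    · have h : (i ∘ π.symm) ∘ π = i := by ext k; simp
      simp [permUnitary, h]
    · intro k _ hk
      have h : i ≠ k ∘ π := by
        rintro rfl
        exact hk (by ext x; simp)
      simp [permUnitary, h]
    · simp
  have h₂ : (tensorPow d M A * permUnitary d M π) i j = tensorPow d M A i (j ∘ π) := by
    simp [Matrix.mul_apply, permUnitary]
  rw [h₁, h₂]
  simp only [tensorPow, Matrix.of_apply, Function.comp_apply]
  rw [← Equiv.prod_comp π]
  simp

lemma trace_permAvg_mul_tensorPow (d M : ℕ) (O : Matrix (Fin M → Fin d) (Fin M → Fin d) ℂ)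
    (A : Matrix (Fin d) (Fin d) ℂ) :
    (permAvg d M O * tensorPow d M A).trace = (O * tensorPow d M A).trace := by
  have h (π : Equiv.Perm (Fin M)) :
      ((permUnitary d M π)ᴴ * O * permUnitary d M π * tensorPow d M A).trace =
        (O * tensorPow d M A).trace := by
    rw [Matrix.mul_assoc, (commute_permUnitary_tensorPow d M π A).eq, ← Matrix.mul_assoc,
      Matrix.trace_mul_comm, Matrix.mul_assoc (permUnitary d M π)ᴴ, ← Matrix.mul_assoc,
      permUnitary_mul_conjTranspose, Matrix.one_mul]
  simp [permAvg, Finset.sum_mul, Matrix.trace_sum, h, Fintype.card_perm, Nat.factorial_ne_zero]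

lemma trace_conj_permAvg_mul_tensorPow (d M : ℕ)
    (O : Matrix (Fin M → Fin d) (Fin M → Fin d) ℂ) (U A : Matrix (Fin d) (Fin d) ℂ) :
    ((tensorPow d M U)ᴴ * permAvg d M O * tensorPow d M U * tensorPow d M A).trace =
      (O * tensorPow d M (U * A * star U)).trace := by
  rw [← trace_permAvg_mul_tensorPow d M O, tensorPow_mul, tensorPow_mul, Matrix.star_eq_conjTranspose,
    tensorPow_conjTranspose, ← Matrix.mul_assoc (permAvg d M O),
    Matrix.trace_mul_comm _ (tensorPow d M U)ᴴ]
  simp only [Matrix.mul_assoc]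

lemma continuous_tensorPow (d M : ℕ) : Continuous (tensorPow d M) := by
  refine continuous_matrix fun i j => ?_
  simp only [tensorPow, Matrix.of_apply]
  fun_prop

lemma isCompact_unitaryGroup (d : ℕ) :
    IsCompact (Matrix.unitaryGroup (Fin d) ℂ : Set (Matrix (Fin d) (Fin d) ℂ)) := by
  refine IsCompact.of_isClosed_subset
    (isCompact_univ_pi fun _ => isCompact_univ_pi fun _ => isCompact_closedBall (0 : ℂ) 1)
    ?_ ?_
  · have h : (Matrix.unitaryGroup (Fin d) ℂ : Set (Matrix (Fin d) (Fin d) ℂ)) =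
        {A | A * star A = 1} := by
      ext A
      exact Matrix.mem_unitaryGroup_iff
    rw [h]
    exact isClosed_eq (by fun_prop) continuous_const
  · intro A hA i _ j _
    simpa using entry_norm_bound_of_unitary hA i j

lemma integrable_of_continuous_unitaryGroup {d : ℕ} {μ : Measure (Matrix.unitaryGroup (Fin d) ℂ)}
    [IsFiniteMeasure μ] {f : Matrix.unitaryGroup (Fin d) ℂ → ℂ} (hf : Continuous f) :
    Integrable f μ := by
  have : CompactSpace (Matrix.unitaryGroup (Fin d) ℂ) :=
    isCompact_iff_compactSpace.mp (isCompact_unitaryGroup d)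
  have : BorelSpace (Matrix.unitaryGroup (Fin d) ℂ) := Subtype.borelSpace _
  exact hf.integrable_of_hasCompactSupport (HasCompactSupport.of_compactSpace f)

lemma integrable_trace_conj {d M : ℕ} {μ : Measure (Matrix.unitaryGroup (Fin d) ℂ)}
    [IsFiniteMeasure μ] (O : Matrix (Fin M → Fin d) (Fin M → Fin d) ℂ)
    (A : Matrix (Fin d) (Fin d) ℂ) :
    Integrable (fun U : Matrix.unitaryGroup (Fin d) ℂ =>
      (O * tensorPow d M ((U : Matrix (Fin d) (Fin d) ℂ) * A * star (U : Matrix _ _ ℂ))).trace)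
      μ := by
  apply integrable_of_continuous_unitaryGroup
  have := continuous_tensorPow d M
  fun_prop

lemma trace_unitaryAvg_mul_tensorPow {d M : ℕ} (μ : Measure (Matrix.unitaryGroup (Fin d) ℂ))
    [IsFiniteMeasure μ] (O : Matrix (Fin M → Fin d) (Fin M → Fin d) ℂ)
    (A : Matrix (Fin d) (Fin d) ℂ) :
    (unitaryAvg d M μ O * tensorPow d M A).trace =
      ∫ U : Matrix.unitaryGroup (Fin d) ℂ,
        (O * tensorPow d M ((U : Matrix (Fin d) (Fin d) ℂ) * A * star (U : Matrix _ _ ℂ))).trace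
        ∂μ := by
  have hint (i j : Fin M → Fin d) : Integrable (fun U : Matrix.unitaryGroup (Fin d) ℂ =>
      ((tensorPow d M (U : Matrix (Fin d) (Fin d) ℂ))ᴴ * permAvg d M O *
        tensorPow d M (U : Matrix (Fin d) (Fin d) ℂ)) i j) μ := by
    apply integrable_of_continuous_unitaryGroup
    have := continuous_tensorPow d M
    refine Continuous.matrix_elem ?_ i j
    fun_prop
  simp_rw [← trace_conj_permAvg_mul_tensorPow]
  simp only [Matrix.trace, Matrix.diag_apply, Matrix.mul_apply (N := tensorPow d M A)]
  rw [integral_finsetSum _ fun i _ => integrable_finsetSum _ fun j _ => (hint i j).mul_const _]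
  refine Finset.sum_congr rfl fun i _ => ?_
  rw [integral_finsetSum _ fun j _ => (hint i j).mul_const _]
  refine Finset.sum_congr rfl fun j _ => ?_
  rw [integral_mul_const]
  rfl

lemma re_trace_unitaryAvg_mul_tensorPow {d M : ℕ} (μ : Measure (Matrix.unitaryGroup (Fin d) ℂ))
    [IsFiniteMeasure μ] (O : Matrix (Fin M → Fin d) (Fin M → Fin d) ℂ)
    (A : Matrix (Fin d) (Fin d) ℂ) :
    (unitaryAvg d M μ O * tensorPow d M A).trace.re =
      ∫ U : Matrix.unitaryGroup (Fin d) ℂ,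
        (O * tensorPow d M
          ((U : Matrix (Fin d) (Fin d) ℂ) * A * star (U : Matrix _ _ ℂ))).trace.re ∂μ := by
  rw [trace_unitaryAvg_mul_tensorPow]
  exact (integral_re (integrable_trace_conj O A)).symm

/-- **Optimality of the doubly averaged measurement (weak Schur sampling).**
For unitarily invariant sets of density matrices `S₀, S₁`, a two-outcome measurement operator
`0 ⪯ O ⪯ I`, and worst-case states `ρ₀ ∈ S₀`, `ρ₁ ∈ S₁`, the doubly averaged operator `Ō̄`
achieves equal or better worst-case type 1 and type 2 errors than `O`:
`Tr(Ō̄ ρ₀^{⊗M}) ≥ Tr(O ρ₀^{⊗M})` and `Tr(Ō̄ ρ₁^{⊗M}) ≤ Tr(O ρ₁^{⊗M})`. -/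
theorem unitaryAvg_worst_case_optimal {d M : ℕ}
    (μ : Measure (Matrix.unitaryGroup (Fin d) ℂ))
    [IsProbabilityMeasure μ] [μ.IsMulLeftInvariant]
    (S₀ S₁ : Set (Matrix (Fin d) (Fin d) ℂ))
    (hS₀dm : ∀ ρ ∈ S₀, ρ.PosSemidef ∧ ρ.trace = 1)
    (hS₁dm : ∀ ρ ∈ S₁, ρ.PosSemidef ∧ ρ.trace = 1)
    (hS₀inv : ∀ ρ ∈ S₀, ∀ U : Matrix.unitaryGroup (Fin d) ℂ,
      (U : Matrix (Fin d) (Fin d) ℂ) * ρ * star (U : Matrix (Fin d) (Fin d) ℂ) ∈ S₀)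
    (hS₁inv : ∀ ρ ∈ S₁, ∀ U : Matrix.unitaryGroup (Fin d) ℂ,
      (U : Matrix (Fin d) (Fin d) ℂ) * ρ * star (U : Matrix (Fin d) (Fin d) ℂ) ∈ S₁)
    (O : Matrix (Fin M → Fin d) (Fin M → Fin d) ℂ)
    (hOherm : O.IsHermitian) (hOpos : O.PosSemidef)
    (hOle : ((1 : Matrix (Fin M → Fin d) (Fin M → Fin d) ℂ) - O).PosSemidef)
    (ρ₀ : Matrix (Fin d) (Fin d) ℂ) (hρ₀ : ρ₀ ∈ S₀)
    (hρ₀min : ∀ σ ∈ S₀, (Matrix.trace (O * tensorPow d M ρ₀)).re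
      ≤ (Matrix.trace (O * tensorPow d M σ)).re)
    (ρ₁ : Matrix (Fin d) (Fin d) ℂ) (hρ₁ : ρ₁ ∈ S₁)
    (hρ₁max : ∀ σ ∈ S₁, (Matrix.trace (O * tensorPow d M σ)).re
      ≤ (Matrix.trace (O * tensorPow d M ρ₁)).re) :
    (Matrix.trace (O * tensorPow d M ρ₀)).re
        ≤ (Matrix.trace (unitaryAvg d M μ O * tensorPow d M ρ₀)).re
      ∧ (Matrix.trace (unitaryAvg d M μ O * tensorPow d M ρ₁)).re
        ≤ (Matrix.trace (O * tensorPow d M ρ₁)).re := by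
  rw [re_trace_unitaryAvg_mul_tensorPow, re_trace_unitaryAvg_mul_tensorPow]
  constructor
  · simpa using integral_mono (μ := μ) (integrable_const _) (integrable_trace_conj O ρ₀).re
      fun U => hρ₀min _ (hS₀inv ρ₀ hρ₀ U)
  · simpa using integral_mono (μ := μ) (integrable_trace_conj O ρ₁).re (integrable_const _)
      fun U => hρ₁max _ (hS₁inv ρ₁ hρ₁ U)
end
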